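/- Preservation of the number of (0,0̄) pairs (Claim 1 of Section 4.4): Let n ≥ 2 and l, k ≥ 1, and let ι : B_l ⊗ B_k → B_k ⊗ B_l be any isomorphism of U_q'(C_n^(1)) crystals. For every b_1 ⊗ b_2 ∈ B_l ⊗ B_k, writing ι(b_1 ⊗ b_2) = b'_2 ⊗ b'_1, one has min(x_0(b_1), x_0(b_2)) = min(x_0(b'_1), x_0(b'_2)). -/

import Mathlib

namespace KTT

/-- Raw data of a crystal element `(x_1,…,x_n,x̄_n,…,x̄_1)`:
`b.1 i` is `x_{i+1}` and `b.2 i` is `x̄_{i+1}` for `i : Fin n`. -/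
abbrev Tup (n : ℕ) := (Fin n → ℕ) × (Fin n → ℕ)

/-- The entry `x_j` (for `1 ≤ j ≤ n`). -/
def xc {n : ℕ} (b : Tup n) (j : ℕ) : ℕ :=
  if h : j - 1 < n then b.1 ⟨j - 1, h⟩ else 0

/-- The entry `x̄_j` (for `1 ≤ j ≤ n`). -/
def xbc {n : ℕ} (b : Tup n) (j : ℕ) : ℕ :=
  if h : j - 1 < n then b.2 ⟨j - 1, h⟩ else 0

/-- Set the entry indexed by `j` (i.e. `x_j`) to the value `v`. -/
def setx {n : ℕ} (f : Fin n → ℕ) (j v : ℕ) : Fin n → ℕ :=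
  fun t => if (t : ℕ) + 1 = j then v else f t

/-- `Σ_{i=1}^n (x_i + x̄_i)`. -/
def tsum {n : ℕ} (b : Tup n) : ℕ := ∑ i, (b.1 i + b.2 i)

/-- The element `(v,0,…,0)`. -/
def uvec (n v : ℕ) : Tup n := (fun j => if (j : ℕ) = 0 then v else 0, fun _ => 0)

/-- The element `(0,v,---,0)` (only `x_2 = v` nonzero). -/
def u2vec (n v : ℕ) : Tup n := (fun j => if (j : ℕ) = 1 then v else 0, fun _ => 0)

/-- The element `(0,0,---,v)` (only `x̄_1 = v` nonzero). -/
def barvec (n v : ℕ) : Tup n := (fun _ => 0, fun j => if (j : ℕ) = 0 then v else 0)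

/-- The element `(a,c,---,d)` with `x_1 = a`, `x_2 = c`, `x̄_1 = d`, all else `0`. -/
def tripleVec (n a c d : ℕ) : Tup n :=
  (fun j => if (j : ℕ) = 0 then a else if (j : ℕ) = 1 then c else 0,
   fun j => if (j : ℕ) = 0 then d else 0)

/-! ### The `U_q'(C_n^{(1)})` crystal `B_l` -/

/-- Membership in the `C_n^{(1)}` crystal `B_l` : the sum of the entries belongs to
`{l, l-2, l-4, …}`. -/
def memC (n l : ℕ) (b : Tup n) : Prop := tsum b ≤ l ∧ (l - tsum b) % 2 = 0

def BC (n l : ℕ) : Set (Tup n) := {b | memC n l b}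

/-- The number `x_0(b)` of `(0,0̄)` pairs. -/
def x0 (l : ℕ) {n : ℕ} (b : Tup n) : ℕ := (l - tsum b) / 2

/-- The operator `ẽ_i` on `B_l` (C case); `none` plays the role of `0`. -/
def eC (n l i : ℕ) (b : Tup n) : Option (Tup n) :=
  if i = 0 then
    if 0 < n then
      if xbc b 1 + 2 ≤ xc b 1 then some (setx b.1 1 (xc b 1 - 2), b.2)
      else if xc b 1 = xbc b 1 + 1 then
        some (setx b.1 1 (xc b 1 - 1), setx b.2 1 (xbc b 1 + 1))
      else if tsum b + 2 ≤ l then some (b.1, setx b.2 1 (xbc b 1 + 2))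
      else none
    else none
  else if i = n then
    if 0 < xbc b n then some (setx b.1 n (xc b n + 1), setx b.2 n (xbc b n - 1))
    else none
  else if i < n then
    if xbc b (i + 1) < xc b (i + 1) then
      some (setx (setx b.1 i (xc b i + 1)) (i + 1) (xc b (i + 1) - 1), b.2)
    else if 0 < xbc b i then
      some (b.1, setx (setx b.2 (i + 1) (xbc b (i + 1) + 1)) i (xbc b i - 1))
    else none
  else none

/-- The operator `f̃_i` on `B_l` (C case). -/
def fC (n l i : ℕ) (b : Tup n) : Option (Tup n) :=
  if i = 0 then
    if 0 < n then
      if xbc b 1 ≤ xc b 1 then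
        if tsum b + 2 ≤ l then some (setx b.1 1 (xc b 1 + 2), b.2) else none
      else if xc b 1 + 1 = xbc b 1 then
        some (setx b.1 1 (xc b 1 + 1), setx b.2 1 (xbc b 1 - 1))
      else some (b.1, setx b.2 1 (xbc b 1 - 2))
    else none
  else if i = n then
    if 0 < xc b n then some (setx b.1 n (xc b n - 1), setx b.2 n (xbc b n + 1))
    else none
  else if i < n then
    if xbc b (i + 1) ≤ xc b (i + 1) then
      if 0 < xc b i then
        some (setx (setx b.1 i (xc b i - 1)) (i + 1) (xc b (i + 1) + 1), b.2)
      else none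
    else some (b.1, setx (setx b.2 (i + 1) (xbc b (i + 1) - 1)) i (xbc b i + 1))
  else none

def eCIter (n l i m : ℕ) (b : Tup n) : Option (Tup n) :=
  (fun o => Option.bind o (eC n l i))^[m] (some b)

def fCIter (n l i m : ℕ) (b : Tup n) : Option (Tup n) :=
  (fun o => Option.bind o (fC n l i))^[m] (some b)

/-- `ε_i(b) = max {m | ẽ_i^m b ≠ 0}` (C case). -/
noncomputable def epsC (n l i : ℕ) (b : Tup n) : ℕ :=
  sSup {m | eCIter n l i m b ≠ none}

/-- `φ_i(b) = max {m | f̃_i^m b ≠ 0}` (C case). -/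
noncomputable def phiC (n l i : ℕ) (b : Tup n) : ℕ :=
  sSup {m | fCIter n l i m b ≠ none}

/-- `ẽ_i` on the tensor product `B_l ⊗ B_k` (C case). -/
noncomputable def eTenC (n l k i : ℕ) (u : Tup n × Tup n) : Option (Tup n × Tup n) :=
  if epsC n k i u.2 ≤ phiC n l i u.1 then (eC n l i u.1).map (fun c => (c, u.2))
  else (eC n k i u.2).map (fun c => (u.1, c))

/-- `f̃_i` on the tensor product `B_l ⊗ B_k` (C case). -/
noncomputable def fTenC (n l k i : ℕ) (u : Tup n × Tup n) : Option (Tup n × Tup n) :=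
  if epsC n k i u.2 < phiC n l i u.1 then (fC n l i u.1).map (fun c => (c, u.2))
  else (fC n k i u.2).map (fun c => (u.1, c))

/-- `ι : B_l ⊗ B_k → B_k ⊗ B_l` is an isomorphism of `U_q'(C_n^{(1)})` crystals. -/
def IsIsoC (n l k : ℕ) (ι : Tup n × Tup n → Tup n × Tup n) : Prop :=
  Set.BijOn ι (BC n l ×ˢ BC n k) (BC n k ×ˢ BC n l) ∧
  ∀ u ∈ BC n l ×ˢ BC n k, ∀ i ≤ n,
    Option.map ι (eTenC n l k i u) = eTenC n k l i (ι u) ∧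
    Option.map ι (fTenC n l k i u) = fTenC n k l i (ι u)

/-- `H` is an energy function for the isomorphism `ι` (C case), normalized by
`H((l,0,…,0) ⊗ (0,k,---,0)) = 0`. -/
def IsEnergyC (n l k : ℕ) (ι : Tup n × Tup n → Tup n × Tup n)
    (H : Tup n × Tup n → ℤ) : Prop :=
  (∀ u ∈ BC n l ×ˢ BC n k, ∀ i ≤ n, ∀ v, eTenC n l k i u = some v →
      H v = H u +
        (if i = 0 then
          (if epsC n k 0 u.2 ≤ phiC n l 0 u.1 ∧ epsC n l 0 (ι u).2 ≤ phiC n k 0 (ι u).1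
           then 1
           else if phiC n l 0 u.1 < epsC n k 0 u.2 ∧ phiC n k 0 (ι u).1 < epsC n l 0 (ι u).2
           then -1 else 0)
         else 0)) ∧
  H (uvec n l, u2vec n k) = 0

/-! ### The `U_q'(A_{2n-1}^{(2)})` crystal `B_l` -/

def memA (n l : ℕ) (b : Tup n) : Prop := tsum b = l

def BA (n l : ℕ) : Set (Tup n) := {b | memA n l b}

/-- The operator `ẽ_i` (A case). -/
def eA (n i : ℕ) (b : Tup n) : Option (Tup n) :=
  if i = 0 then
    if 1 < n then
      if xbc b 2 < xc b 2 then some (setx b.1 2 (xc b 2 - 1), setx b.2 1 (xbc b 1 + 1))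
      else if 0 < xc b 1 then some (setx b.1 1 (xc b 1 - 1), setx b.2 2 (xbc b 2 + 1))
      else none
    else none
  else if i = n then
    if 0 < xbc b n then some (setx b.1 n (xc b n + 1), setx b.2 n (xbc b n - 1))
    else none
  else if i < n then
    if xbc b (i + 1) < xc b (i + 1) then
      some (setx (setx b.1 i (xc b i + 1)) (i + 1) (xc b (i + 1) - 1), b.2)
    else if 0 < xbc b i then
      some (b.1, setx (setx b.2 (i + 1) (xbc b (i + 1) + 1)) i (xbc b i - 1))
    else none
  else none

/-- The operator `f̃_i` (A case). -/
def fA (n i : ℕ) (b : Tup n) : Option (Tup n) :=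
  if i = 0 then
    if 1 < n then
      if xbc b 2 ≤ xc b 2 then
        if 0 < xbc b 1 then some (setx b.1 2 (xc b 2 + 1), setx b.2 1 (xbc b 1 - 1))
        else none
      else some (setx b.1 1 (xc b 1 + 1), setx b.2 2 (xbc b 2 - 1))
    else none
  else if i = n then
    if 0 < xc b n then some (setx b.1 n (xc b n - 1), setx b.2 n (xbc b n + 1))
    else none
  else if i < n then
    if xbc b (i + 1) ≤ xc b (i + 1) then
      if 0 < xc b i then
        some (setx (setx b.1 i (xc b i - 1)) (i + 1) (xc b (i + 1) + 1), b.2)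
      else none
    else some (b.1, setx (setx b.2 (i + 1) (xbc b (i + 1) - 1)) i (xbc b i + 1))
  else none

def eAIter (n i m : ℕ) (b : Tup n) : Option (Tup n) :=
  (fun o => Option.bind o (eA n i))^[m] (some b)

def fAIter (n i m : ℕ) (b : Tup n) : Option (Tup n) :=
  (fun o => Option.bind o (fA n i))^[m] (some b)

noncomputable def epsA (n i : ℕ) (b : Tup n) : ℕ :=
  sSup {m | eAIter n i m b ≠ none}

noncomputable def phiA (n i : ℕ) (b : Tup n) : ℕ :=
  sSup {m | fAIter n i m b ≠ none}

/-- `ẽ_i` on a tensor product (A case). -/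
noncomputable def eTenA (n i : ℕ) (u : Tup n × Tup n) : Option (Tup n × Tup n) :=
  if epsA n i u.2 ≤ phiA n i u.1 then (eA n i u.1).map (fun c => (c, u.2))
  else (eA n i u.2).map (fun c => (u.1, c))

/-- `f̃_i` on a tensor product (A case). -/
noncomputable def fTenA (n i : ℕ) (u : Tup n × Tup n) : Option (Tup n × Tup n) :=
  if epsA n i u.2 < phiA n i u.1 then (fA n i u.1).map (fun c => (c, u.2))
  else (fA n i u.2).map (fun c => (u.1, c))

/-- `ι : B_l ⊗ B_k → B_k ⊗ B_l` is an isomorphism of `U_q'(A_{2n-1}^{(2)})` crystals. -/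
def IsIsoA (n l k : ℕ) (ι : Tup n × Tup n → Tup n × Tup n) : Prop :=
  Set.BijOn ι (BA n l ×ˢ BA n k) (BA n k ×ˢ BA n l) ∧
  ∀ u ∈ BA n l ×ˢ BA n k, ∀ i ≤ n,
    Option.map ι (eTenA n i u) = eTenA n i (ι u) ∧
    Option.map ι (fTenA n i u) = fTenA n i (ι u)

/-- `H` is an energy function for `ι` (A case), normalized by
`H((l,0,…,0) ⊗ (0,0,---,k)) = 0`. -/
def IsEnergyA (n l k : ℕ) (ι : Tup n × Tup n → Tup n × Tup n)
    (H : Tup n × Tup n → ℤ) : Prop :=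
  (∀ u ∈ BA n l ×ˢ BA n k, ∀ i ≤ n, ∀ v, eTenA n i u = some v →
      H v = H u +
        (if i = 0 then
          (if epsA n 0 u.2 ≤ phiA n 0 u.1 ∧ epsA n 0 (ι u).2 ≤ phiA n 0 (ι u).1
           then 1
           else if phiA n 0 u.1 < epsA n 0 u.2 ∧ phiA n 0 (ι u).1 < epsA n 0 (ι u).2
           then -1 else 0)
         else 0)) ∧
  H (uvec n l, barvec n k) = 0

/-! ### Words, tableaux and column insertion

Letters are encoded as natural numbers: the unbarred letter `j` (for `0 ≤ j ≤ n`) is `j`,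
and the barred letter `j̄` is `2n+1-j`; the natural order of `ℕ` is the order
`0 < 1 < ⋯ < n < n̄ < ⋯ < 1̄ < 0̄`.  A (two-row) tableau is encoded as the list of its
columns (left to right), each column being the list of its entries (top to bottom). -/

/-- The barred partner `j̄` of an unbarred letter `j`. -/
def bar (n j : ℕ) : ℕ := 2 * n + 1 - j

/-- Column insertion of a letter into a tableau with at most two rows. -/
def insertLetter (n : ℕ) : ℕ → List (List ℕ) → List (List ℕ)
  | a, [] => [[a]]
  | a, [p] :: rest =>
      if a ≤ p then [a] :: insertLetter n p rest else [p, a] :: rest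
  | a, [p, q] :: rest =>
      if p ≠ 0 ∧ p ≤ n ∧ q = bar n p ∧ p ≤ a ∧ a ≤ q then
        -- the column is a pair `(x, x̄)` with `x ≠ 0` and `x ≤ a ≤ x̄`
        [p - 1, a] :: insertLetter n (bar n (p - 1)) rest
      else if n + 1 ≤ q ∧ bar n q < p ∧ p < q ∧ a = bar n q ∧ q ≠ n + 1 then
        -- the column is `(β, x̄)` with `x < β < x̄`, `a = x` and `x ≠ n`
        [a + 1, bar n (a + 1)] :: insertLetter n p rest
      else if a ≤ p then [a, q] :: insertLetter n p rest
      else if a ≤ q then [p, a] :: insertLetter n q rest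
      else [p, q, a] :: rest
  | a, C :: rest => (C ++ [a]) :: rest

/-- Column insertion of a word `u = u_1 ⋯ u_j` into a tableau: `u_j` first, `u_1` last. -/
def insertWord (n : ℕ) (u : List ℕ) (T : List (List ℕ)) : List (List ℕ) :=
  u.foldr (fun a T => insertLetter n a T) T

/-- One step of reverse insertion: letter `g` comes back (moving leftward) into a column;
returns the restored column together with the letter passed further left. -/
def revStep (n g : ℕ) (C : List ℕ) : List ℕ × ℕ :=
  match C with
  | [p] => ([g], p)
  | [p, q] =>
      if p ≠ 0 ∧ p ≤ n ∧ q = bar n p ∧ p ≤ g ∧ g ≤ q then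
        ([g, bar n (p - 1)], p - 1)
      else if p ≤ n ∧ g = bar n p ∧ p < q ∧ q < g ∧ p ≠ n then
        ([p + 1, bar n (p + 1)], q)
      else if q ≤ g then ([p, g], q)
      else ([g, q], p)
  | _ => (C, g)

/-- Reverse insertion of a letter through a list of columns, from right to left;
returns the new columns and the letter ejected from the leftmost column. -/
def revPass (n g : ℕ) : List (List ℕ) → List (List ℕ) × ℕ
  | [] => ([], g)
  | C :: rest =>
      let p := revPass n g rest
      let q := revStep n p.2 C
      (q.1 :: p.1, q.2)

/-- Reverse-bump the rightmost cell of the first row (the last column, a single box). -/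
def rbFirst (n : ℕ) (T : List (List ℕ)) : List (List ℕ) × ℕ :=
  match T.getLast? with
  | some [a] => revPass n a T.dropLast
  | _ => (T, 0)

/-- Number of columns of height (at least) two, i.e. the length of the second row. -/
def numTwoCols (T : List (List ℕ)) : ℕ :=
  (T.filter (fun C => decide (2 ≤ C.length))).length

/-- Reverse-bump the rightmost cell of the second row. -/
def rbSecond (n : ℕ) (T : List (List ℕ)) : List (List ℕ) × ℕ :=
  match (T.drop (numTwoCols T - 1)).head? with
  | some [a, b] =>
      let p := revPass n b (T.take (numTwoCols T - 1))
      (p.1 ++ [a] :: T.drop (numTwoCols T), p.2)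
  | _ => (T, 0)

/-- Iterate a reverse-bumping step, collecting the ejected letters in order of ejection. -/
def rbIter (step : List (List ℕ) → List (List ℕ) × ℕ) :
    ℕ → List (List ℕ) → List (List ℕ) × List ℕ
  | 0, T => (T, [])
  | c + 1, T =>
      let p := step T
      let q := rbIter step c p.1
      (q.1, p.2 :: q.2)

/-- A one-row word regarded as a tableau (list of one-box columns). -/
def rowCols (w : List ℕ) : List (List ℕ) := w.map (fun a => [a])

/-- The row word of a one-row tableau. -/
def colsWord (T : List (List ℕ)) : List ℕ := T.foldr (fun C acc => C ++ acc) []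

/-- The word `1^{x_1} ⋯ n^{x_n} n̄^{x̄_n} ⋯ 1̄^{x̄_1}`. -/
def coreWord (n : ℕ) (b : Tup n) : List ℕ :=
  ((List.finRange n).map (fun i => List.replicate (b.1 i) ((i : ℕ) + 1))).foldr (· ++ ·) []
  ++ ((List.finRange n).reverse.map
      (fun i => List.replicate (b.2 i) (bar n ((i : ℕ) + 1)))).foldr (· ++ ·) []

/-- The word `𝕋(b) = 0^{x_0} 1^{x_1} ⋯ 1̄^{x̄_1} 0̄^{x_0}` of an element of the
`C_n^{(1)}` crystal `B_l`. -/
def rowWordC (n l : ℕ) (b : Tup n) : List ℕ :=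
  List.replicate (x0 l b) 0 ++ coreWord n b ++ List.replicate (x0 l b) (bar n 0)

/-- The word `𝕋(b)` with `z` pairs `(0, 0̄)` removed. -/
def hatWordC (n l z : ℕ) (b : Tup n) : List ℕ :=
  List.replicate (x0 l b - z) 0 ++ coreWord n b ++ List.replicate (x0 l b - z) (bar n 0)

/-- The word `𝒯(b) = 1^{x_1} ⋯ 1̄^{x̄_1}` of an element of the `A_{2n-1}^{(2)}` crystal. -/
def rowWordA (n : ℕ) (b : Tup n) : List ℕ := coreWord n b



/-! ### Proof -/

def yc {n : ℕ} (f : Fin n → ℕ) (j : ℕ) : ℕ := if h : j - 1 < n then f ⟨j - 1, h⟩ else 0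

lemma xc_eq {n : ℕ} (b : Tup n) (j : ℕ) : xc b j = yc b.1 j := rfl
lemma xbc_eq {n : ℕ} (b : Tup n) (j : ℕ) : xbc b j = yc b.2 j := rfl

lemma yc_setx {n : ℕ} (f : Fin n → ℕ) (j v m : ℕ) (h1 : 1 ≤ m) (h2 : m ≤ n) :
    yc (setx f j v) m = if m = j then v else yc f m := by
  have h : m - 1 < n := by omega
  simp only [yc, setx, h, dif_pos]
  have : m - 1 + 1 = m := by omega
  simp [this]

lemma setx_setx {n : ℕ} (f : Fin n → ℕ) (j v w : ℕ) : setx (setx f j v) j w = setx f j w := by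
  funext t; simp only [setx]; split_ifs <;> rfl

lemma setx_self {n : ℕ} (f : Fin n → ℕ) (j v : ℕ) (hv : v = yc f j) : setx f j v = f := by
  funext t; simp only [setx]; split_ifs with h
  · subst hv; subst h; simp [yc]
  · rfl

def LL {n : ℕ} (c : ℕ → ℤ) (f : Fin n → ℕ) : ℤ := ∑ t : Fin n, c ((t : ℕ) + 1) * (f t : ℤ)

lemma LL_setx {n : ℕ} (c : ℕ → ℤ) (f : Fin n → ℕ) (j v : ℕ) (h1 : 1 ≤ j) (h2 : j ≤ n) :
    LL c (setx f j v) = LL c f + c j * ((v : ℤ) - (yc f j : ℤ)) := by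
  have hj : j - 1 < n := by omega
  have key : LL c (setx f j v) - LL c f = c j * ((v : ℤ) - (yc f j : ℤ)) := by
    unfold LL
    rw [← Finset.sum_sub_distrib, Finset.sum_eq_single (⟨j - 1, hj⟩ : Fin n)]
    · have : j - 1 + 1 = j := by omega
      simp [setx, yc, hj, this]; ring
    · intro t _ ht
      have : ¬ ((t : ℕ) + 1 = j) := by
        intro h; apply ht; ext; simp; omega
      simp [setx, this]
    · simp
  linarith

lemma tsum_LL {n : ℕ} (b : Tup n) : (tsum b : ℤ) = LL (fun _ => 1) b.1 + LL (fun _ => 1) b.2 := by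
  simp [tsum, LL, Finset.sum_add_distrib]

/-- potential -/
def PP {n : ℕ} (b : Tup n) : ℤ :=
  LL (fun j => (n : ℤ) + 1 - j) b.1 - LL (fun j => (n : ℤ) + 1 - j) b.2

lemma mem_BC {n l : ℕ} (b : Tup n) : b ∈ BC n l ↔ tsum b + 2 * x0 l b = l := by
  show (_ ∧ _) ↔ _
  unfold x0; omega

lemma mem_BC' {n l : ℕ} (b : Tup n) (x : ℕ) (h : (tsum b : ℤ) + 2 * x = l) :
    b ∈ BC n l ∧ x0 l b = x := by
  rw [mem_BC]; unfold x0; omega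

def epsF (n l i : ℕ) (b : Tup n) : ℕ :=
  if i = 0 then x0 l b + (xc b 1 - xbc b 1)
  else if i = n then xbc b n
  else xbc b i + (xc b (i + 1) - xbc b (i + 1))

def phiF (n l i : ℕ) (b : Tup n) : ℕ :=
  if i = 0 then x0 l b + (xbc b 1 - xc b 1)
  else if i = n then xc b n
  else xc b i + (xbc b (i + 1) - xc b (i + 1))

lemma eC_step {n l i : ℕ} (hn : 2 ≤ n) (hi : i ≤ n) {b : Tup n} (hb : b ∈ BC n l) :
    (eC n l i b = none ∧ epsF n l i b = 0) ∨ ∃ b', eC n l i b = some b' ∧ b' ∈ BC n l ∧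
      epsF n l i b' + 1 = epsF n l i b ∧ phiF n l i b' = phiF n l i b + 1 ∧
      (1 ≤ i → x0 l b' = x0 l b ∧ PP b + 1 ≤ PP b') ∧
      (i = 0 → min (x0 l b) (epsF n l i b - 1) ≤ x0 l b') := by
  have hb' := (mem_BC b).1 hb
  have hT := tsum_LL b
  have h1n : 1 ≤ n := by omega
  rcases Nat.eq_zero_or_pos i with rfl | hi0
  · simp only [eC, epsF, phiF, if_true, show 0 < n by omega]
    split_ifs with h1 h2 h3
    · right; refine ⟨_, rfl, ?_⟩
      obtain ⟨hm, hx⟩ := mem_BC' (n := n) (l := l) (setx b.1 1 (xc b 1 - 2), b.2) (x0 l b + 1) (by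
        rw [tsum_LL]; simp only [LL_setx _ _ _ _ le_rfl h1n]
        simp only [xc_eq, xbc_eq] at *; omega)
      refine ⟨hm, ?_⟩; rw [hx]
      simp only [xc_eq, xbc_eq, yc_setx _ _ _ _ le_rfl h1n, if_true] at *
      omega
    · right; refine ⟨_, rfl, ?_⟩
      obtain ⟨hm, hx⟩ := mem_BC' (n := n) (l := l) (setx b.1 1 (xc b 1 - 1), setx b.2 1 (xbc b 1 + 1)) (x0 l b) (by
        rw [tsum_LL]; simp only [LL_setx _ _ _ _ le_rfl h1n]
        simp only [xc_eq, xbc_eq] at *; omega)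
      refine ⟨hm, ?_⟩; rw [hx]
      simp only [xc_eq, xbc_eq, yc_setx _ _ _ _ le_rfl h1n, if_true] at *
      omega
    · right; refine ⟨_, rfl, ?_⟩
      obtain ⟨hm, hx⟩ := mem_BC' (n := n) (l := l) (b.1, setx b.2 1 (xbc b 1 + 2)) (x0 l b - 1) (by
        rw [tsum_LL]; simp only [LL_setx _ _ _ _ le_rfl h1n]
        simp only [xc_eq, xbc_eq] at *; omega)
      refine ⟨hm, ?_⟩; rw [hx]
      simp only [xc_eq, xbc_eq, yc_setx _ _ _ _ le_rfl h1n, if_true] at *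
      omega
    · left; refine ⟨rfl, ?_⟩; omega
  · have hi0' : i ≠ 0 := by omega
    rcases eq_or_ne i n with rfl | hin
    · simp only [eC, epsF, phiF, if_true, hi0', if_false]
      split_ifs with h1
      · right; refine ⟨_, rfl, ?_⟩
        obtain ⟨hm, hx⟩ := mem_BC' (n := i) (l := l) (setx b.1 i (xc b i + 1), setx b.2 i (xbc b i - 1)) (x0 l b) (by
          rw [tsum_LL]; simp only [LL_setx _ _ _ _ h1n le_rfl]
          simp only [xc_eq, xbc_eq] at *; omega)
        refine ⟨hm, ?_⟩; rw [hx]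
        simp only [PP, LL_setx _ _ _ _ h1n le_rfl]
        simp only [xc_eq, xbc_eq, yc_setx _ _ _ _ h1n le_rfl, if_true] at *
        refine ⟨by omega, by first | omega | trivial, fun _ => ⟨trivial, ?_⟩, by omega⟩
        push_cast [h1]; ring_nf; omega
      · left; refine ⟨rfl, ?_⟩; omega
    · have hlt : i < n := by omega
      have h2n : i + 1 ≤ n := by omega
      have h11 : 1 ≤ i + 1 := by omega
      have e1 : i + 1 ≠ i := by omega
      have e2 : i ≠ i + 1 := by omega
      simp only [eC, epsF, phiF, hi0', if_false, hin, hlt, if_true]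
      split_ifs with h1 h2
      · right; refine ⟨_, rfl, ?_⟩
        obtain ⟨hm, hx⟩ := mem_BC' (n := n) (l := l) (setx (setx b.1 i (xc b i + 1)) (i + 1) (xc b (i + 1) - 1), b.2) (x0 l b) (by
          rw [tsum_LL]; simp only [LL_setx _ _ _ _ h11 h2n, LL_setx _ _ _ _ hi0 hi, yc_setx _ _ _ _ h11 h2n, e1, if_false]
          simp only [xc_eq, xbc_eq] at *; omega)
        refine ⟨hm, ?_⟩; rw [hx]
        simp only [PP, LL_setx _ _ _ _ h11 h2n, LL_setx _ _ _ _ hi0 hi]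
        simp only [xc_eq, xbc_eq, yc_setx _ _ _ _ h11 h2n, yc_setx _ _ _ _ hi0 hi, if_true, e1, e2, if_false] at *
        refine ⟨by omega, by first | omega | trivial, fun _ => ⟨trivial, ?_⟩, by omega⟩
        have h0 : 1 ≤ yc b.1 (i + 1) := by omega
        push_cast [h0]; ring_nf; omega
      · right; refine ⟨_, rfl, ?_⟩
        obtain ⟨hm, hx⟩ := mem_BC' (n := n) (l := l) (b.1, setx (setx b.2 (i + 1) (xbc b (i + 1) + 1)) i (xbc b i - 1)) (x0 l b) (by
          rw [tsum_LL]; simp only [LL_setx _ _ _ _ h11 h2n, LL_setx _ _ _ _ hi0 hi, yc_setx _ _ _ _ hi0 hi, e2, if_false]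
          simp only [xc_eq, xbc_eq] at *; omega)
        refine ⟨hm, ?_⟩; rw [hx]
        simp only [PP, LL_setx _ _ _ _ h11 h2n, LL_setx _ _ _ _ hi0 hi]
        simp only [xc_eq, xbc_eq, yc_setx _ _ _ _ h11 h2n, yc_setx _ _ _ _ hi0 hi, if_true, e1, e2, if_false] at *
        refine ⟨by omega, by first | omega | trivial, fun _ => ⟨trivial, ?_⟩, by omega⟩
        have h0 : 1 ≤ yc b.2 i := by omega
        push_cast [h0]; ring_nf; omega
      · left; refine ⟨rfl, ?_⟩; omega

lemma fC_step {n l i : ℕ} (hn : 2 ≤ n) (hi : i ≤ n) {b : Tup n} (hb : b ∈ BC n l) :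
    (fC n l i b = none ∧ phiF n l i b = 0) ∨ ∃ b', fC n l i b = some b' ∧ b' ∈ BC n l ∧
      phiF n l i b' + 1 = phiF n l i b ∧ epsF n l i b' = epsF n l i b + 1 ∧
      (i = 0 → min (x0 l b) (phiF n l i b - 1) ≤ x0 l b' ∧ eC n l i b' = some b) ∧
      (1 ≤ i → x0 l b' = x0 l b) := by
  have hb' := (mem_BC b).1 hb
  have hT := tsum_LL b
  have h1n : 1 ≤ n := by omega
  rcases Nat.eq_zero_or_pos i with rfl | hi0
  · simp only [fC, epsF, phiF, if_true, show 0 < n by omega]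
    split_ifs with h1 h2 h3
    · right; refine ⟨_, rfl, ?_⟩
      obtain ⟨hm, hx⟩ := mem_BC' (n := n) (l := l) (setx b.1 1 (xc b 1 + 2), b.2) (x0 l b - 1) (by
        rw [tsum_LL]; simp only [LL_setx _ _ _ _ le_rfl h1n]
        simp only [xc_eq, xbc_eq] at *; omega)
      refine ⟨hm, ?_⟩; rw [hx]
      simp only [eC, if_true, show 0 < n by omega]
      simp only [xc_eq, xbc_eq, yc_setx _ _ _ _ le_rfl h1n, if_true] at *
      refine ⟨by omega, by omega, fun _ => ⟨by omega, ?_⟩, by omega⟩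
      rw [if_pos (by omega), setx_setx, setx_self _ _ _ (by omega)]
    · left; refine ⟨rfl, ?_⟩; omega
    · right; refine ⟨_, rfl, ?_⟩
      obtain ⟨hm, hx⟩ := mem_BC' (n := n) (l := l) (setx b.1 1 (xc b 1 + 1), setx b.2 1 (xbc b 1 - 1)) (x0 l b) (by
        rw [tsum_LL]; simp only [LL_setx _ _ _ _ le_rfl h1n]
        simp only [xc_eq, xbc_eq] at *; omega)
      refine ⟨hm, ?_⟩; rw [hx]
      simp only [eC, if_true, show 0 < n by omega]
      simp only [xc_eq, xbc_eq, yc_setx _ _ _ _ le_rfl h1n, if_true] at *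
      refine ⟨by omega, by omega, fun _ => ⟨by omega, ?_⟩, by omega⟩
      rw [if_neg (by omega), if_pos (by omega), setx_setx, setx_self _ _ _ (by omega), setx_setx, setx_self _ _ _ (by omega)]
    · right; refine ⟨_, rfl, ?_⟩
      obtain ⟨hm, hx⟩ := mem_BC' (n := n) (l := l) (b.1, setx b.2 1 (xbc b 1 - 2)) (x0 l b + 1) (by
        rw [tsum_LL]; simp only [LL_setx _ _ _ _ le_rfl h1n]
        simp only [xc_eq, xbc_eq] at *; omega)
      have hm' := (mem_BC _).1 hm
      refine ⟨hm, ?_⟩; rw [hx] at hm' ⊢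
      simp only [eC, if_true, show 0 < n by omega]
      simp only [xc_eq, xbc_eq, yc_setx _ _ _ _ le_rfl h1n, if_true] at *
      refine ⟨by omega, by omega, fun _ => ⟨by omega, ?_⟩, by omega⟩
      rw [if_neg (by omega), if_neg (by omega), if_pos (by omega), setx_setx, setx_self _ _ _ (by omega)]
  · have hi0' : i ≠ 0 := by omega
    rcases eq_or_ne i n with rfl | hin
    · simp only [fC, epsF, phiF, if_true, hi0', if_false]
      split_ifs with h1
      · right; refine ⟨_, rfl, ?_⟩
        obtain ⟨hm, hx⟩ := mem_BC' (n := i) (l := l) (setx b.1 i (xc b i - 1), setx b.2 i (xbc b i + 1)) (x0 l b) (by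
          rw [tsum_LL]; simp only [LL_setx _ _ _ _ h1n le_rfl]
          simp only [xc_eq, xbc_eq] at *; omega)
        refine ⟨hm, ?_⟩
        simp only [xc_eq, xbc_eq, yc_setx _ _ _ _ h1n le_rfl, if_true] at *
        refine ⟨by omega, by simp, by simp, fun _ => hx⟩
      · left; refine ⟨rfl, ?_⟩; omega
    · have hlt : i < n := by omega
      have h2n : i + 1 ≤ n := by omega
      have h11 : 1 ≤ i + 1 := by omega
      have e1 : i + 1 ≠ i := by omega
      have e2 : i ≠ i + 1 := by omega
      simp only [fC, epsF, phiF, hi0', if_false, hin, hlt, if_true]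
      split_ifs with h1 h2
      · right; refine ⟨_, rfl, ?_⟩
        obtain ⟨hm, hx⟩ := mem_BC' (n := n) (l := l) (setx (setx b.1 i (xc b i - 1)) (i + 1) (xc b (i + 1) + 1), b.2) (x0 l b) (by
          rw [tsum_LL]; simp only [LL_setx _ _ _ _ h11 h2n, LL_setx _ _ _ _ hi0 hi, yc_setx _ _ _ _ h11 h2n, e1, if_false]
          simp only [xc_eq, xbc_eq] at *; omega)
        refine ⟨hm, ?_⟩
        simp only [xc_eq, xbc_eq, yc_setx _ _ _ _ h11 h2n, yc_setx _ _ _ _ hi0 hi, if_true, e1, e2, if_false] at *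
        refine ⟨by omega, by omega, by simp, fun _ => hx⟩
      · left; refine ⟨rfl, ?_⟩; omega
      · right; refine ⟨_, rfl, ?_⟩
        obtain ⟨hm, hx⟩ := mem_BC' (n := n) (l := l) (b.1, setx (setx b.2 (i + 1) (xbc b (i + 1) - 1)) i (xbc b i + 1)) (x0 l b) (by
          rw [tsum_LL]; simp only [LL_setx _ _ _ _ h11 h2n, LL_setx _ _ _ _ hi0 hi, yc_setx _ _ _ _ hi0 hi, e2, if_false]
          simp only [xc_eq, xbc_eq] at *; omega)
        refine ⟨hm, ?_⟩
        simp only [xc_eq, xbc_eq, yc_setx _ _ _ _ h11 h2n, yc_setx _ _ _ _ hi0 hi, if_true, e1, e2, if_false] at *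
        refine ⟨by omega, by omega, by simp, fun _ => hx⟩

/-- explicit f_1 on elements without `2̄` -/
lemma fC_one {n l : ℕ} (hn : 2 ≤ n) {b : Tup n} (hb : b ∈ BC n l) (h2 : xbc b 2 = 0) (h1 : 0 < xc b 1) :
    ∃ b', fC n l 1 b = some b' ∧ b' ∈ BC n l ∧ x0 l b' = x0 l b ∧ xc b' 1 + 1 = xc b 1 ∧
      xc b' 2 = xc b 2 + 1 ∧ xbc b' 1 = xbc b 1 ∧ xbc b' 2 = 0 ∧ PP b' + 1 = PP b := by
  have hb' := (mem_BC b).1 hb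
  have hT := tsum_LL b
  have h1n : 1 ≤ n := by omega
  refine ⟨(setx (setx b.1 1 (xc b 1 - 1)) 2 (xc b 2 + 1), b.2), ?_, ?_⟩
  · have : (1 : ℕ) ≠ n := by omega
    have : 1 < n := by omega
    simp [fC, *]
  · obtain ⟨hm, hx⟩ := mem_BC' (n := n) (l := l) (setx (setx b.1 1 (xc b 1 - 1)) 2 (xc b 2 + 1), b.2) (x0 l b) (by
      rw [tsum_LL]; simp only [LL_setx _ _ 2 _ (by omega) hn, LL_setx _ _ 1 _ le_rfl h1n, yc_setx _ _ _ 2 (by omega) hn]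
      simp only [xc_eq, xbc_eq] at *; simp; omega)
    refine ⟨hm, hx, ?_⟩
    simp only [PP, LL_setx _ _ 2 _ (by omega) hn, LL_setx _ _ 1 _ le_rfl h1n]
    simp only [xc_eq, xbc_eq, yc_setx _ _ _ 2 (by omega) hn, yc_setx _ _ _ 1 le_rfl h1n] at *
    refine ⟨by simp; omega, by simp, by simp, h2, ?_⟩
    push_cast [h1]; simp; ring

/-- explicit f_0 -/
lemma fC_zero {n l : ℕ} (hn : 2 ≤ n) {b b' : Tup n} (hb : b ∈ BC n l) (h : fC n l 0 b = some b') :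
    b' ∈ BC n l ∧ xc b' 2 = xc b 2 ∧ xbc b' 2 = xbc b 2 ∧ PP b' = PP b + 2 * n ∧
    ((xbc b 1 ≤ xc b 1 ∧ xc b' 1 = xc b 1 + 2 ∧ xbc b' 1 = xbc b 1 ∧ x0 l b' + 1 = x0 l b) ∨
     (xc b 1 + 1 = xbc b 1 ∧ xc b' 1 = xc b 1 + 1 ∧ xbc b' 1 + 1 = xbc b 1 ∧ x0 l b' = x0 l b) ∨
     (xc b 1 + 2 ≤ xbc b 1 ∧ xc b' 1 = xc b 1 ∧ xbc b' 1 + 2 = xbc b 1 ∧ x0 l b' = x0 l b + 1)) := by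
  have hb' := (mem_BC b).1 hb
  have hT := tsum_LL b
  have h1n : 1 ≤ n := by omega
  simp only [fC, if_true, show 0 < n by omega] at h
  split_ifs at h with h1 h2 h3
  · cases h
    obtain ⟨hm, hx⟩ := mem_BC' (n := n) (l := l) (setx b.1 1 (xc b 1 + 2), b.2) (x0 l b - 1) (by
        rw [tsum_LL]; simp only [LL_setx _ _ _ _ le_rfl h1n]
        simp only [xc_eq, xbc_eq] at *; omega)
    refine ⟨hm, ?_⟩; rw [hx]
    simp only [PP, LL_setx _ _ _ _ le_rfl h1n]
    simp only [xc_eq, xbc_eq, yc_setx _ _ _ _ le_rfl h1n, yc_setx _ _ _ 2 (by omega) hn, if_true] at *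
    refine ⟨by simp, by simp, by push_cast; ring, by simp; omega⟩
  · cases h
    obtain ⟨hm, hx⟩ := mem_BC' (n := n) (l := l) (setx b.1 1 (xc b 1 + 1), setx b.2 1 (xbc b 1 - 1)) (x0 l b) (by
        rw [tsum_LL]; simp only [LL_setx _ _ _ _ le_rfl h1n]
        simp only [xc_eq, xbc_eq] at *; omega)
    refine ⟨hm, ?_⟩; rw [hx]
    simp only [PP, LL_setx _ _ _ _ le_rfl h1n]
    simp only [xc_eq, xbc_eq, yc_setx _ _ _ _ le_rfl h1n, yc_setx _ _ _ 2 (by omega) hn, if_true] at *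
    have h0 : 1 ≤ yc b.2 1 := by omega
    refine ⟨by simp, by simp, by push_cast [h0]; ring, by simp; omega⟩
  · cases h
    obtain ⟨hm, hx⟩ := mem_BC' (n := n) (l := l) (b.1, setx b.2 1 (xbc b 1 - 2)) (x0 l b + 1) (by
        rw [tsum_LL]; simp only [LL_setx _ _ _ _ le_rfl h1n]
        simp only [xc_eq, xbc_eq] at *; omega)
    refine ⟨hm, ?_⟩; rw [hx]
    simp only [PP, LL_setx _ _ _ _ le_rfl h1n]
    simp only [xc_eq, xbc_eq, yc_setx _ _ _ _ le_rfl h1n, yc_setx _ _ _ 2 (by omega) hn, if_true] at *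
    have h0 : 2 ≤ yc b.2 1 := by omega
    refine ⟨by simp, by simp, by push_cast [h0]; ring, by simp; omega⟩

lemma iter_none {α : Type*} (F : α → Option α) (m : ℕ) :
    (fun o => Option.bind o F)^[m] none = none := by
  induction m with
  | zero => rfl
  | succ m ih => rw [Function.iterate_succ_apply]; exact ih

lemma sup_iter {α : Type*} (F : α → Option α) (S : Set α) (g : α → ℕ)
    (h : ∀ b ∈ S, (F b = none ∧ g b = 0) ∨ ∃ b', F b = some b' ∧ b' ∈ S ∧ g b' + 1 = g b)
    (b : α) (hb : b ∈ S) :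
    sSup {m | (fun o => Option.bind o F)^[m] (some b) ≠ none} = g b := by
  have key : ∀ m, ∀ b ∈ S, ((fun o => Option.bind o F)^[m] (some b) ≠ none ↔ m ≤ g b) := by
    intro m
    induction m with
    | zero => intro b _; simp
    | succ m ih =>
      intro b hb
      rw [Function.iterate_succ_apply]
      show (fun o => Option.bind o F)^[m] (F b) ≠ none ↔ _
      rcases h b hb with ⟨h1, h2⟩ | ⟨b', h1, h2, h3⟩
      · rw [h1, iter_none]; simp; omega
      · rw [h1, ih b' h2]; omega
  have : {m | (fun o => Option.bind o F)^[m] (some b) ≠ none} = Set.Iic (g b) := by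
    ext m; exact key m b hb
  rw [this, csSup_Iic]

lemma epsC_eq {n l i : ℕ} (hn : 2 ≤ n) (hi : i ≤ n) {b : Tup n} (hb : b ∈ BC n l) :
    epsC n l i b = epsF n l i b := by
  refine sup_iter (eC n l i) (BC n l) (epsF n l i) ?_ b hb
  intro b hb
  rcases eC_step hn hi hb with h | ⟨b', h1, h2, h3, _⟩
  · exact Or.inl h
  · exact Or.inr ⟨b', h1, h2, h3⟩

lemma phiC_eq {n l i : ℕ} (hn : 2 ≤ n) (hi : i ≤ n) {b : Tup n} (hb : b ∈ BC n l) :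
    phiC n l i b = phiF n l i b := by
  refine sup_iter (fC n l i) (BC n l) (phiF n l i) ?_ b hb
  intro b hb
  rcases fC_step hn hi hb with h | ⟨b', h1, h2, h3, _⟩
  · exact Or.inl h
  · exact Or.inr ⟨b', h1, h2, h3⟩

def epsT (n l k i : ℕ) (u : Tup n × Tup n) : ℕ :=
  epsF n l i u.1 + (epsF n k i u.2 - phiF n l i u.1)
def phiT (n l k i : ℕ) (u : Tup n × Tup n) : ℕ :=
  phiF n k i u.2 + (phiF n l i u.1 - epsF n k i u.2)
def PT {n : ℕ} (u : Tup n × Tup n) : ℤ := PP u.1 + PP u.2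

lemma x0_le_eps {n l : ℕ} (b : Tup n) : x0 l b ≤ epsF n l 0 b := by simp [epsF]
lemma x0_le_phi {n l : ℕ} (b : Tup n) : x0 l b ≤ phiF n l 0 b := by simp [phiF]

lemma eTen_step {n l k i : ℕ} (hn : 2 ≤ n) (hi : i ≤ n) {u : Tup n × Tup n}
    (h1 : u.1 ∈ BC n l) (h2 : u.2 ∈ BC n k) :
    (eTenC n l k i u = none ∧ epsT n l k i u = 0) ∨ ∃ u', eTenC n l k i u = some u' ∧
      u'.1 ∈ BC n l ∧ u'.2 ∈ BC n k ∧ epsT n l k i u' + 1 = epsT n l k i u ∧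
      phiT n l k i u' = phiT n l k i u + 1 ∧
      (1 ≤ i → PT u + 1 ≤ PT u' ∧ x0 l u'.1 = x0 l u.1 ∧ x0 k u'.2 = x0 k u.2) ∧
      (i = 0 → ∀ z, z ≤ x0 l u.1 → z ≤ x0 k u.2 → z + 1 ≤ epsT n l k i u →
        z ≤ x0 l u'.1 ∧ z ≤ x0 k u'.2) := by
  unfold eTenC
  rw [epsC_eq hn hi h2, phiC_eq hn hi h1]
  split_ifs with hc
  · rcases eC_step hn hi h1 with ⟨ha, hb⟩ | ⟨b', ha, hb, hc1, hc2, hc3, hc4⟩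
    · left; rw [ha]; refine ⟨rfl, ?_⟩; unfold epsT; omega
    · right; rw [ha]; refine ⟨(b', u.2), rfl, hb, h2, ?_, ?_, ?_, ?_⟩
      · simp only [epsT]; omega
      · simp only [phiT]; omega
      · intro h; have := hc3 h; simp only [PT]; refine ⟨?_, ?_, trivial⟩ <;> omega
      · intro h z hz1 hz2 hz3
        have := hc4 h
        simp only [epsT] at hz3 ⊢; omega
  · rcases eC_step hn hi h2 with ⟨ha, hb⟩ | ⟨b', ha, hb, hc1, hc2, hc3, hc4⟩
    · omega
    · right; rw [ha]; refine ⟨(u.1, b'), rfl, h1, hb, ?_, ?_, ?_, ?_⟩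
      · simp only [epsT]; omega
      · simp only [phiT]; omega
      · intro h; have := hc3 h; simp only [PT]; refine ⟨?_, trivial, ?_⟩ <;> omega
      · intro h z hz1 hz2 hz3
        have := hc4 h
        subst h
        have := x0_le_phi (l := l) u.1
        simp only [epsT] at hz3 ⊢; omega

lemma fTen_step {n l k i : ℕ} (hn : 2 ≤ n) (hi : i ≤ n) {u : Tup n × Tup n}
    (h1 : u.1 ∈ BC n l) (h2 : u.2 ∈ BC n k) :
    (fTenC n l k i u = none ∧ phiT n l k i u = 0) ∨ ∃ u', fTenC n l k i u = some u' ∧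
      u'.1 ∈ BC n l ∧ u'.2 ∈ BC n k ∧ phiT n l k i u' + 1 = phiT n l k i u ∧
      epsT n l k i u' = epsT n l k i u + 1 ∧
      (i = 0 → eTenC n l k i u' = some u ∧
       ∀ z, z ≤ x0 l u.1 → z ≤ x0 k u.2 → z + 1 ≤ phiT n l k i u →
        z ≤ x0 l u'.1 ∧ z ≤ x0 k u'.2) ∧
      (1 ≤ i → x0 l u'.1 = x0 l u.1 ∧ x0 k u'.2 = x0 k u.2) := by
  unfold fTenC
  rw [epsC_eq hn hi h2, phiC_eq hn hi h1]
  split_ifs with hc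
  · rcases fC_step hn hi h1 with ⟨ha, hb⟩ | ⟨b', ha, hb, hc1, hc2, hc3, hc4⟩
    · omega
    · right; rw [ha]; refine ⟨(b', u.2), rfl, hb, h2, ?_, ?_, ?_, fun h => ⟨hc4 h, rfl⟩⟩
      · simp only [phiT]; omega
      · simp only [epsT]; omega
      · intro h
        obtain ⟨hd1, hd2⟩ := hc3 h
        refine ⟨?_, ?_⟩
        · unfold eTenC
          simp only
          rw [epsC_eq hn hi h2, phiC_eq hn hi hb, if_pos (by omega), hd2]; rfl
        · intro z hz1 hz2 hz3
          subst h
          have := x0_le_eps (l := k) u.2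
          simp only [phiT] at hz3 ⊢; omega
  · rcases fC_step hn hi h2 with ⟨ha, hb⟩ | ⟨b', ha, hb, hc1, hc2, hc3, hc4⟩
    · left; rw [ha]; refine ⟨rfl, ?_⟩; unfold phiT; omega
    · right; rw [ha]; refine ⟨(u.1, b'), rfl, h1, hb, ?_, ?_, ?_, fun h => ⟨rfl, hc4 h⟩⟩
      · simp only [phiT]; omega
      · simp only [epsT]; omega
      · intro h
        obtain ⟨hd1, hd2⟩ := hc3 h
        refine ⟨?_, ?_⟩
        · unfold eTenC
          simp only
          rw [epsC_eq hn hi hb, phiC_eq hn hi h1, if_neg (by omega), hd2]; rfl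
        · intro z hz1 hz2 hz3
          simp only [phiT] at hz3 ⊢; omega

lemma iso_mem {n l k : ℕ} {ι : Tup n × Tup n → Tup n × Tup n} (hι : IsIsoC n l k ι)
    {u : Tup n × Tup n} (h1 : u.1 ∈ BC n l) (h2 : u.2 ∈ BC n k) :
    (ι u).1 ∈ BC n k ∧ (ι u).2 ∈ BC n l := hι.1.mapsTo ⟨h1, h2⟩

lemma iso_phi {n l k i : ℕ} (hn : 2 ≤ n) (hi : i ≤ n) {ι : Tup n × Tup n → Tup n × Tup n}
    (hι : IsIsoC n l k ι) : ∀ (m : ℕ) (u : Tup n × Tup n), u.1 ∈ BC n l → u.2 ∈ BC n k →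
      phiT n l k i u = m → phiT n k l i (ι u) = m := by
  intro m
  induction m with
  | zero =>
    intro u h1 h2 hm
    obtain ⟨h1', h2'⟩ := iso_mem hι h1 h2
    have hf := (hι.2 u ⟨h1, h2⟩ i hi).2
    rcases fTen_step hn hi h1 h2 with ⟨ha, _⟩ | ⟨u', ha, _, _, hb, _⟩
    · rw [ha] at hf
      rcases fTen_step hn hi h1' h2' with ⟨_, hb⟩ | ⟨v', hb, _⟩
      · exact hb
      · rw [hb] at hf; simp at hf
    · omega
  | succ m ih =>
    intro u h1 h2 hm
    obtain ⟨h1', h2'⟩ := iso_mem hι h1 h2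
    have hf := (hι.2 u ⟨h1, h2⟩ i hi).2
    rcases fTen_step hn hi h1 h2 with ⟨ha, _⟩ | ⟨u', ha, hu1, hu2, hb, _⟩
    · omega
    · have := ih u' hu1 hu2 (by omega)
      rw [ha] at hf
      rcases fTen_step hn hi h1' h2' with ⟨hc, _⟩ | ⟨v', hc, _, _, hd, _⟩
      · rw [hc] at hf; simp at hf
      · rw [hc] at hf; simp at hf; subst hf; omega

lemma iso_eps {n l k i : ℕ} (hn : 2 ≤ n) (hi : i ≤ n) {ι : Tup n × Tup n → Tup n × Tup n}
    (hι : IsIsoC n l k ι) : ∀ (m : ℕ) (u : Tup n × Tup n), u.1 ∈ BC n l → u.2 ∈ BC n k →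
      epsT n l k i u = m → epsT n k l i (ι u) = m := by
  intro m
  induction m with
  | zero =>
    intro u h1 h2 hm
    obtain ⟨h1', h2'⟩ := iso_mem hι h1 h2
    have hf := (hι.2 u ⟨h1, h2⟩ i hi).1
    rcases eTen_step hn hi h1 h2 with ⟨ha, _⟩ | ⟨u', ha, _, _, hb, _⟩
    · rw [ha] at hf
      rcases eTen_step hn hi h1' h2' with ⟨_, hb⟩ | ⟨v', hb, _⟩
      · exact hb
      · rw [hb] at hf; simp at hf
    · omega
  | succ m ih =>
    intro u h1 h2 hm
    obtain ⟨h1', h2'⟩ := iso_mem hι h1 h2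
    have hf := (hι.2 u ⟨h1, h2⟩ i hi).1
    rcases eTen_step hn hi h1 h2 with ⟨ha, _⟩ | ⟨u', ha, hu1, hu2, hb, _⟩
    · omega
    · have := ih u' hu1 hu2 (by omega)
      rw [ha] at hf
      rcases eTen_step hn hi h1' h2' with ⟨hc, _⟩ | ⟨v', hc, _, _, hd, _⟩
      · rw [hc] at hf; simp at hf
      · rw [hc] at hf; simp at hf; subst hf; omega

lemma tsum_four {n : ℕ} (hn : 2 ≤ n) (b : Tup n)
    (h : ∀ j, 3 ≤ j → j ≤ n → xc b j = 0 ∧ xbc b j = 0) :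
    tsum b = xc b 1 + xc b 2 + xbc b 1 + xbc b 2 := by
  obtain ⟨m, rfl⟩ : ∃ m, n = m + 2 := ⟨n - 2, by omega⟩
  unfold tsum
  rw [Fin.sum_univ_succ, Fin.sum_univ_succ, Finset.sum_eq_zero]
  · simp [xc, xbc]; ring
  · intro t _
    have := h (t + 3) (by omega) (by omega)
    simp only [xc, xbc, show (t : ℕ) + 3 - 1 < m + 2 by omega, dif_pos] at this
    exact Nat.add_eq_zero_iff.2 this

lemma four_le_tsum {n : ℕ} (hn : 2 ≤ n) (b : Tup n) :
    xc b 1 + xc b 2 + xbc b 1 + xbc b 2 ≤ tsum b := by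
  obtain ⟨m, rfl⟩ : ∃ m, n = m + 2 := ⟨n - 2, by omega⟩
  unfold tsum
  rw [Fin.sum_univ_succ, Fin.sum_univ_succ]
  have h : xc b 1 = b.1 0 ∧ xbc b 1 = b.2 0 ∧ xc b 2 = b.1 (Fin.succ 0) ∧ xbc b 2 = b.2 (Fin.succ 0) := by
    simp [xc, xbc]
  rw [h.1, h.2.1, h.2.2.1, h.2.2.2]; omega

lemma PP_le {n l : ℕ} (b : Tup n) (hb : b ∈ BC n l) : PP b ≤ n * l := by
  have h1 : PP b ≤ n * tsum b := by
    unfold PP LL tsum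
    rw [← Finset.sum_sub_distrib]
    push_cast
    rw [Finset.mul_sum]
    apply Finset.sum_le_sum
    intro t _
    have ht : ((t : ℕ) : ℤ) < n := by exact_mod_cast t.2
    have h0 : (0 : ℤ) ≤ (t : ℕ) := by positivity
    have h2 : (0 : ℤ) ≤ b.1 t := by positivity
    have h3 : (0 : ℤ) ≤ b.2 t := by positivity
    nlinarith [mul_nonneg h0 h2, mul_nonneg (sub_nonneg.2 ht.le) h3, mul_nonneg h0 h3]
  have h2 : (tsum b : ℤ) ≤ l := by
    have := (mem_BC b).1 hb; omega
  have h3 : (0 : ℤ) ≤ n := by positivity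
  nlinarith

lemma epsF_one {n l : ℕ} (hn : 2 ≤ n) (b : Tup n) :
    epsF n l 1 b = xbc b 1 + (xc b 2 - xbc b 2) := by
  have : (1 : ℕ) ≠ n := by omega
  simp [epsF, this]
lemma phiF_one {n l : ℕ} (hn : 2 ≤ n) (b : Tup n) :
    phiF n l 1 b = xc b 1 + (xbc b 2 - xc b 2) := by
  have : (1 : ℕ) ≠ n := by omega
  simp [phiF, this]
lemma epsF_zero {n l : ℕ} (b : Tup n) : epsF n l 0 b = x0 l b + (xc b 1 - xbc b 1) := by
  simp [epsF]
lemma phiF_zero {n l : ℕ} (b : Tup n) : phiF n l 0 b = x0 l b + (xbc b 1 - xc b 1) := by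
  simp [phiF]

lemma T_empty (n l k w : ℕ) (hn : 2 ≤ n) (T : Set (Tup n × Tup n))
    (hmem : ∀ v ∈ T, v.1 ∈ BC n l ∧ v.2 ∈ BC n k)
    (hx : ∀ v ∈ T, w ≤ x0 l v.1 ∧ w ≤ x0 k v.2 ∧ (x0 l v.1 = w ∨ x0 k v.2 = w))
    (hφ : ∀ v ∈ T, w + 1 ≤ phiT n l k 0 v)
    (hwt : ∀ v ∈ T, (xc v.1 1 : ℤ) + xc v.1 2 + xc v.2 1 + xc v.2 2
      - xbc v.1 1 - xbc v.1 2 - xbc v.2 1 - xbc v.2 2 + 4 * (w + 1) ≤ l + k)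
    (he : ∀ v ∈ T, ∀ i, 1 ≤ i → i ≤ n → ∀ v', eTenC n l k i v = some v' → v' ∈ T)
    (hf1 : ∀ v ∈ T, ∀ v', fTenC n l k 1 v = some v' → v' ∈ T)
    (hf0 : ∀ v ∈ T, w + 2 ≤ phiT n l k 0 v → ∀ v', fTenC n l k 0 v = some v' → v' ∈ T) :
    ∀ v, v ∉ T := by
  intro v0 hv0
  obtain ⟨M, ⟨v, hv, rfl⟩, hmax⟩ := Int.exists_greatest_of_bdd (P := fun z => ∃ v ∈ T, PT v = z)
    ⟨n * l + n * k, by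
      rintro z ⟨v, hv, rfl⟩
      have := PP_le v.1 (hmem v hv).1
      have := PP_le v.2 (hmem v hv).2
      unfold PT; linarith⟩ ⟨_, v0, hv0, rfl⟩
  replace hmax : ∀ v' ∈ T, PT v' ≤ PT v := fun v' h => hmax _ ⟨v', h, rfl⟩
  -- climbing with `e_1`
  have climb : ∀ m : ℕ, ∀ v' ∈ T, m ≤ epsT n l k 1 v' → ∃ v'' ∈ T, PT v' + m ≤ PT v'' := by
    intro m
    induction m with
    | zero => intro v' h _; exact ⟨v', h, by simp⟩
    | succ m ih =>
      intro v' h hm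
      rcases eTen_step (i := 1) hn (by omega) (hmem v' h).1 (hmem v' h).2 with
        ⟨_, hb⟩ | ⟨u', ha, _, _, hb, _, hc, _⟩
      · omega
      · have hu' := he v' h 1 le_rfl (by omega) u' ha
        obtain ⟨v'', h1, h2⟩ := ih u' hu' (by omega)
        have := (hc le_rfl).1
        exact ⟨v'', h1, by push_cast; linarith⟩
  -- the `f_0` step
  have fzero : ∀ v' ∈ T, w + 2 ≤ phiT n l k 0 v' → ∃ v'' ∈ T, PT v'' = PT v' + 2 * n ∧
      ((epsF n k 0 v'.2 < phiF n l 0 v'.1 ∧ v''.2 = v'.2 ∧ fC n l 0 v'.1 = some v''.1) ∨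
       (phiF n l 0 v'.1 ≤ epsF n k 0 v'.2 ∧ v''.1 = v'.1 ∧ fC n k 0 v'.2 = some v''.2)) := by
    intro v' h hp
    obtain ⟨m1, m2⟩ := hmem v' h
    rcases fTen_step (i := 0) hn (by omega) m1 m2 with ⟨_, hb⟩ | ⟨u', ha, _⟩
    · omega
    · refine ⟨u', hf0 v' h hp u' ha, ?_⟩
      unfold fTenC at ha
      rw [epsC_eq hn (by omega) m2, phiC_eq hn (by omega) m1] at ha
      split_ifs at ha with hc
      · simp only [Option.map_eq_some_iff] at ha
        obtain ⟨c, hc1, rfl⟩ := ha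
        refine ⟨?_, Or.inl ⟨hc, rfl, hc1⟩⟩
        have := (fC_zero hn m1 hc1).2.2.2.1
        simp only [PT]; linarith
      · simp only [Option.map_eq_some_iff] at ha
        obtain ⟨c, hc1, rfl⟩ := ha
        refine ⟨?_, Or.inr ⟨by omega, rfl, hc1⟩⟩
        have := (fC_zero hn m2 hc1).2.2.2.1
        simp only [PT]; linarith
  -- `v` is highest
  obtain ⟨m1, m2⟩ := hmem v hv
  have high : ∀ i, 1 ≤ i → i ≤ n → epsT n l k i v = 0 := by
    intro i h1 h2
    rcases eTen_step hn h2 m1 m2 with ⟨_, hb⟩ | ⟨u', ha, _, _, hb, _, hc, _⟩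
    · exact hb
    · have := hmax u' (he v hv i h1 h2 u' ha)
      have := (hc h1).1
      omega
  have phi0 : phiT n l k 0 v = w + 1 := by
    have := hφ v hv
    by_contra hne
    obtain ⟨v'', h1, h2, _⟩ := fzero v hv (by omega)
    have := hmax v'' h1
    omega
  have c1 : ∀ j, 1 ≤ j → j ≤ n → xbc v.1 j = 0 := by
    intro j h1 h2
    have e : epsF n l j v.1 = 0 := by
      have := high j h1 h2
      unfold epsT at this
      omega
    unfold epsF at e
    rw [if_neg (by omega)] at e
    split_ifs at e with h
    · subst h; exact e
    · omega
  have c2 : ∀ j, 2 ≤ j → j ≤ n → xc v.1 j = 0 := by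
    intro j h1 h2
    obtain ⟨i, rfl⟩ : ∃ i, j = i + 1 := ⟨j - 1, by omega⟩
    have := high i (by omega) (by omega)
    have := c1 (i + 1) (by omega) h2
    unfold epsT at this
    have e : epsF n l i v.1 = xbc v.1 i + (xc v.1 (i + 1) - xbc v.1 (i + 1)) := by
      unfold epsF; rw [if_neg (by omega), if_neg (by omega)]
    unfold epsT at *
    omega
  have c3 : ∀ j, 2 ≤ j → j ≤ n → epsF n k j v.2 = 0 := by
    intro j h1 h2
    have h3 := high j (by omega) h2
    have h4 : phiF n l j v.1 = 0 := by
      unfold phiF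
      rw [if_neg (by omega)]
      split_ifs with h
      · subst h; exact c2 _ h1 h2
      · have := c2 j h1 h2
        have := c1 (j + 1) (by omega) (by omega)
        omega
    unfold epsT at h3
    omega
  have c4 : ∀ j, 2 ≤ j → j ≤ n → xbc v.2 j = 0 := by
    intro j h1 h2
    have := c3 j h1 h2
    unfold epsF at this
    rw [if_neg (by omega)] at this
    split_ifs at this with h
    · subst h; omega
    · omega
  have c5 : ∀ j, 3 ≤ j → j ≤ n → xc v.2 j = 0 := by
    intro j h1 h2
    obtain ⟨i, rfl⟩ : ∃ i, j = i + 1 := ⟨j - 1, by omega⟩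
    have h3 := c3 i (by omega) (by omega)
    have h4 := c4 (i + 1) (by omega) h2
    unfold epsF at h3
    rw [if_neg (by omega), if_neg (by omega)] at h3
    omega
  have t1 := tsum_four hn v.1 (fun j h1 h2 => ⟨c2 j (by omega) h2, c1 j (by omega) h2⟩)
  have t2 := tsum_four hn v.2 (fun j h1 h2 => ⟨c5 j h1 h2, c4 j (by omega) h2⟩)
  have d1 := c1 1 le_rfl (by omega)
  have d2 := c1 2 (by omega) hn
  have d3 := c2 2 le_rfl hn
  have d4 := c4 2 le_rfl hn
  have hh := high 1 le_rfl (by omega)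
  unfold epsT at hh
  rw [epsF_one hn, epsF_one hn, phiF_one hn] at hh
  have w0 := hwt v hv
  have x00 := hx v hv
  have b1 := (mem_BC _).1 m1
  have b2 := (mem_BC _).1 m2
  have phi0' := phi0
  unfold phiT at phi0'
  rw [epsF_zero, phiF_zero, phiF_zero] at phi0'
  have hqr : xbc v.2 1 + xc v.2 2 ≤ xc v.1 1 := by clear phi0' b1 b2 w0 t1 t2 phi0; omega
  have hJ : ∃ J, 1 ≤ J ∧ J ≤ xc v.2 1 ∧
      ((x0 l v.1 = w ∧ x0 k v.2 = w + 1 ∧ J + xbc v.2 1 = xc v.2 1 + 1) ∨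
       (x0 l v.1 = w ∧ x0 k v.2 = w ∧ xbc v.2 1 = xc v.2 1 + 1 ∧ J = 1) ∨
       (x0 k v.2 = w ∧ x0 l v.1 + xbc v.2 1 = w + 1 + xc v.2 1 ∧ xbc v.2 1 ≤ xc v.2 1 ∧ J = 1)) := by
    have w1 : 2 * (w + 1) ≤ x0 l v.1 + x0 k v.2 + xbc v.2 1 := by
      clear phi0' hh phi0 hqr; omega
    clear hh phi0 w0 t1 t2 b1 b2
    rw [d1] at phi0'
    obtain ⟨x1, x2, x3⟩ := x00
    generalize x0 l v.1 = x at *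
    generalize x0 k v.2 = y at *
    generalize xc v.2 1 = p at *
    generalize xbc v.2 1 = r at *
    by_cases hc : x = w ∧ y = w + 1
    · exact ⟨p - r + 1, by omega, by omega, Or.inl (by omega)⟩
    · exact ⟨1, by omega, by omega, Or.inr (by omega)⟩
  clear hh phi0 w0 t1 t2 b1 b2 phi0' x00
  -- lowering with `f_1`
  have chain1 : ∀ j, j + (xbc v.2 1 + xc v.2 2) ≤ xc v.1 1 → ∃ v' ∈ T, v'.2 = v.2 ∧
      xc v'.1 1 + j = xc v.1 1 ∧ xc v'.1 2 = j ∧ xbc v'.1 1 = 0 ∧ xbc v'.1 2 = 0 ∧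
      x0 l v'.1 = x0 l v.1 ∧ PT v' + j = PT v := by
    intro j
    induction j with
    | zero => intro _; exact ⟨v, hv, rfl, rfl, d3, d1, d2, rfl, by simp⟩
    | succ j ih =>
      intro hj
      obtain ⟨v', h, e1, e2, e3, e4, e5, e6, e7⟩ := ih (by omega)
      obtain ⟨q1, q2⟩ := hmem v' h
      obtain ⟨b', r1, r2, r3, r4, r5, r6, r7, r8⟩ := fC_one hn q1 e5 (by omega)
      have hs : fTenC n l k 1 v' = some (b', v'.2) := by
        unfold fTenC
        rw [epsC_eq hn (by omega) q2, phiC_eq hn (by omega) q1, epsF_one hn, phiF_one hn, e1,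
          if_pos (by omega), r1]; rfl
      refine ⟨_, hf1 v' h _ hs, e1, ?_⟩
      simp only [PT] at e7 ⊢
      push_cast
      rw [e1] at e7 ⊢
      refine ⟨by omega, by omega, by omega, by omega, by omega, by linarith⟩
  obtain ⟨vc, hvc, f1, f2, f3, f4, f5, f6, f7⟩ :=
    chain1 (xc v.1 1 - (xbc v.2 1 + xc v.2 2)) (by omega)
  have f2'' : xc vc.1 1 = xbc v.2 1 + xc v.2 2 := by clear hJ; omega
  have chain2 : ∀ j, j ≤ xc v.2 1 → ∃ v' ∈ T, v'.1 = vc.1 ∧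
      xc v'.2 1 + j = xc v.2 1 ∧ xc v'.2 2 = xc v.2 2 + j ∧ xbc v'.2 1 = xbc v.2 1 ∧
      xbc v'.2 2 = 0 ∧ x0 k v'.2 = x0 k v.2 ∧ PT v' + j = PT vc := by
    intro j
    induction j with
    | zero => intro _; refine ⟨vc, hvc, rfl, ?_⟩; rw [f1]; simp [d4]
    | succ j ih =>
      intro hj
      obtain ⟨v', h, e1, e2, e3, e4, e5, e6, e7⟩ := ih (by omega)
      obtain ⟨q1, q2⟩ := hmem v' h
      obtain ⟨b', r1, r2, r3, r4, r5, r6, r7, r8⟩ := fC_one hn q2 e5 (by omega)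
      have hs : fTenC n l k 1 v' = some (v'.1, b') := by
        unfold fTenC
        rw [epsC_eq hn (by omega) q2, phiC_eq hn (by omega) q1, epsF_one hn, phiF_one hn, e1,
          if_neg (by omega), r1]; rfl
      refine ⟨_, hf1 v' h _ hs, e1, ?_⟩
      simp only [PT] at e7 ⊢
      push_cast
      clear hs r1 f2 f3 f4 f5 f6 f7 f2''
      refine ⟨by omega, by omega, by omega, by omega, by omega, by linarith⟩
  obtain ⟨J, hJ1, hJ2, hJ3⟩ := hJ
  obtain ⟨v', h, e1, e2, e3, e4, e5, e6, e7⟩ := chain2 J hJ2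
  obtain ⟨q1, q2⟩ := hmem v' h
  have f7' : PT vc + xc v.1 1 = PT v + (xbc v.2 1 + xc v.2 2) := by
    clear hJ3; omega
  have f3' : xc vc.1 2 + (xbc v.2 1 + xc v.2 2) = xc v.1 1 := by
    clear hJ3; omega
  have f2' : xc vc.1 1 = xbc v.2 1 + xc v.2 2 := by
    clear hJ3; omega
  clear f2 f3 f7
  rw [← e1] at f2' f3' f4 f5 f6
  clear d1 d2 d3 d4
  have hp : w + 2 ≤ phiT n l k 0 v' := by
    unfold phiT; rw [epsF_zero, phiF_zero, phiF_zero, f4, f6, e4, e6]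
    clear f7' e7 f3' f5 e5
    rcases hJ3 with hJ3 | hJ3 | hJ3 <;> omega
  obtain ⟨v'', h'', g1, g2⟩ := fzero v' h hp
  clear hp
  have key : xc v.1 1 + J ≤ epsT n l k 1 v'' + 1 + (xbc v.2 1 + xc v.2 2) := by
    unfold epsT
    rw [epsF_one hn, epsF_one hn, phiF_one hn]
    rw [epsF_zero, phiF_zero, f4, f6, e6, e4] at g2
    clear e7 f7' g1
    rcases g2 with ⟨g2, g3, g4⟩ | ⟨g2, g3, g4⟩
    · obtain ⟨_, z1, z2, _, z3⟩ := fC_zero hn q1 g4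
      rw [g3, z1, z2, e4, e5, e3, f5]
      rw [f4] at z3
      rcases hJ3 with hJ3 | hJ3 | hJ3 <;> omega
    · obtain ⟨_, z1, z2, _, z3⟩ := fC_zero hn q2 g4
      rw [g3, z1, z2, e5, e3, f5, f4]
      rw [e4] at z3
      rcases hJ3 with hJ3 | hJ3 | hJ3 <;> omega
  obtain ⟨v3, h3, h4⟩ := climb _ v'' h'' le_rfl
  have := hmax v3 h3
  clear hJ3 g2 e2 e3 e4 e5 e6 f4 f5 f6 f2' f3'
  omega

lemma core (n l k : ℕ) (hn : 2 ≤ n) (ι : Tup n × Tup n → Tup n × Tup n)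
    (hι : IsIsoC n l k ι) : ∀ (z : ℕ) (u : Tup n × Tup n), u.1 ∈ BC n l → u.2 ∈ BC n k →
      z ≤ x0 l u.1 → z ≤ x0 k u.2 → z ≤ x0 k (ι u).1 ∧ z ≤ x0 l (ι u).2 := by
  intro z
  induction z with
  | zero => intros; exact ⟨Nat.zero_le _, Nat.zero_le _⟩
  | succ w ih =>
    have main := T_empty n k l w hn {v | ∃ u : Tup n × Tup n, u.1 ∈ BC n l ∧ u.2 ∈ BC n k ∧
      w + 1 ≤ x0 l u.1 ∧ w + 1 ≤ x0 k u.2 ∧ ι u = v ∧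
      ¬ (w + 1 ≤ x0 k v.1 ∧ w + 1 ≤ x0 l v.2)} ?_ ?_ ?_ ?_ ?_ ?_ ?_
    · intro u h1 h2 h3 h4
      by_contra hc
      exact main (ι u) ⟨u, h1, h2, h3, h4, rfl, hc⟩
    · rintro _ ⟨u, h1, h2, h3, h4, rfl, hc⟩
      exact iso_mem hι h1 h2
    · rintro _ ⟨u, h1, h2, h3, h4, rfl, hc⟩
      have := ih u h1 h2 (by omega) (by omega)
      omega
    · rintro _ ⟨u, h1, h2, h3, h4, rfl, hc⟩
      rw [iso_phi hn (by omega) hι _ u h1 h2 rfl]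
      have := x0_le_phi (l := k) u.2
      unfold phiT; omega
    · rintro _ ⟨u, h1, h2, h3, h4, rfl, hc⟩
      have p0 := iso_phi hn (i := 0) (by omega) hι _ u h1 h2 rfl
      have p1 := iso_phi hn (i := 1) (by omega) hι _ u h1 h2 rfl
      have e0 := iso_eps hn (i := 0) (by omega) hι _ u h1 h2 rfl
      have e1 := iso_eps hn (i := 1) (by omega) hι _ u h1 h2 rfl
      have q1 : ∀ (l k : ℕ) (u : Tup n × Tup n), (phiT n l k 0 u : ℤ) - epsT n l k 0 u
          = xbc u.1 1 - xc u.1 1 + xbc u.2 1 - xc u.2 1 := by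
        intro l k u
        unfold phiT epsT
        rw [epsF_zero, epsF_zero, phiF_zero, phiF_zero]
        omega
      have q2 : ∀ (l k : ℕ) (u : Tup n × Tup n), (phiT n l k 1 u : ℤ) - epsT n l k 1 u
          = xc u.1 1 - xbc u.1 1 + xc u.2 1 - xbc u.2 1 
            - (xc u.1 2 - xbc u.1 2 + xc u.2 2 - xbc u.2 2) := by
        intro l k u
        unfold phiT epsT
        rw [epsF_one hn, epsF_one hn, phiF_one hn, phiF_one hn]
        omega
      have a1 := q1 l k u
      have a2 := q2 l k u
      have a3 := q1 k l (ι u)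
      have a4 := q2 k l (ι u)
      rw [p0, e0] at a3
      rw [p1, e1] at a4
      have s1 := four_le_tsum hn u.1
      have s2 := four_le_tsum hn u.2
      have r1 := (mem_BC _).1 h1
      have r2 := (mem_BC _).1 h2
      clear p0 p1 e0 e1 hc q1 q2
      linarith
    · rintro _ ⟨u, h1, h2, h3, h4, rfl, hc⟩ i hi1 hi2 v' hv'
      obtain ⟨m1, m2⟩ := iso_mem hι h1 h2
      have hf := (hι.2 u ⟨h1, h2⟩ i hi2).1
      rw [hv'] at hf
      rcases eTen_step hn hi2 h1 h2 with ⟨ha, _⟩ | ⟨u', ha, g1, g2, _, _, g3, _⟩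
      · rw [ha] at hf; simp at hf
      rcases eTen_step hn hi2 m1 m2 with ⟨hb, _⟩ | ⟨v'', hb, _, _, _, _, g4, _⟩
      · rw [hb] at hv'; simp at hv'
      rw [ha] at hf; rw [hb] at hv'
      simp only [Option.map_some, Option.some.injEq] at hf hv'
      subst hv'
      have := g3 hi1
      have := g4 hi1
      exact ⟨u', g1, g2, by omega, by omega, hf, by omega⟩
    · rintro _ ⟨u, h1, h2, h3, h4, rfl, hc⟩ v' hv'
      obtain ⟨m1, m2⟩ := iso_mem hι h1 h2
      have hi2 : 1 ≤ n := by omega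
      have hf := (hι.2 u ⟨h1, h2⟩ 1 hi2).2
      rw [hv'] at hf
      rcases fTen_step hn hi2 h1 h2 with ⟨ha, _⟩ | ⟨u', ha, g1, g2, _, _, _, g3⟩
      · rw [ha] at hf; simp at hf
      rcases fTen_step hn hi2 m1 m2 with ⟨hb, _⟩ | ⟨v'', hb, _, _, _, _, _, g4⟩
      · rw [hb] at hv'; simp at hv'
      rw [ha] at hf; rw [hb] at hv'
      simp only [Option.map_some, Option.some.injEq] at hf hv'
      subst hv'
      have := g3 le_rfl
      have := g4 le_rfl
      exact ⟨u', g1, g2, by omega, by omega, hf, by omega⟩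
    · rintro _ ⟨u, h1, h2, h3, h4, rfl, hc⟩ hp v' hv'
      obtain ⟨m1, m2⟩ := iso_mem hι h1 h2
      have hi2 : 0 ≤ n := by omega
      have hf := (hι.2 u ⟨h1, h2⟩ 0 hi2).2
      rw [hv'] at hf
      have hp' := iso_phi hn hi2 hι _ u h1 h2 rfl
      have he' := iso_eps hn hi2 hι _ u h1 h2 rfl
      rcases fTen_step hn hi2 h1 h2 with ⟨ha, _⟩ | ⟨u', ha, g1, g2, g5, g6, g3, _⟩
      · rw [ha] at hf; simp at hf
      rcases fTen_step hn hi2 m1 m2 with ⟨hb, _⟩ | ⟨v'', hb, k1, k2, k5, k6, g4, _⟩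
      · rw [hb] at hv'; simp at hv'
      rw [ha] at hf; rw [hb] at hv'
      simp only [Option.map_some, Option.some.injEq] at hf hv'
      subst hv'
      obtain ⟨_, g3⟩ := g3 rfl
      obtain ⟨g4, _⟩ := g4 rfl
      have g7 := g3 (w + 1) h3 h4 (by omega)
      refine ⟨u', g1, g2, g7.1, g7.2, hf, ?_⟩
      rintro ⟨y1, y2⟩
      apply hc
      rcases eTen_step hn hi2 k1 k2 with ⟨hb, _⟩ | ⟨v3, hb, _, _, _, _, _, g8⟩
      · rw [hb] at g4; simp at g4
      rw [hb] at g4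
      simp only [Option.some.injEq] at g4
      subst g4
      refine g8 rfl (w + 1) y1 y2 ?_
      have := x0_le_eps (l := l) u.1
      have : w + 1 ≤ epsT n l k 0 u := by unfold epsT; omega
      omega

lemma iso_symm (n l k : ℕ) (hn : 2 ≤ n) (ι : Tup n × Tup n → Tup n × Tup n)
    (hι : IsIsoC n l k ι) : ∃ ι', IsIsoC n k l ι' ∧ ∀ u, u.1 ∈ BC n l → u.2 ∈ BC n k →
      ι' (ι u) = u := by
  have hinv := hι.1.invOn_invFunOn
  refine ⟨Function.invFunOn ι (BC n l ×ˢ BC n k), ⟨?_, ?_⟩, ?_⟩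
  · exact hι.1.symm hinv.symm
  · intro v hv i hi
    obtain ⟨u, hu, rfl⟩ := hι.1.surjOn hv
    rw [hinv.1 hu]
    obtain ⟨h1, h2⟩ := hι.2 u hu i hi
    rw [← h1, ← h2]
    constructor
    · rcases eTen_step hn hi hu.1 hu.2 with ⟨ha, _⟩ | ⟨u', ha, g1, g2, _⟩
      · rw [ha]; rfl
      · rw [ha]; simp only [Option.map_some, Option.some.injEq]
        exact hinv.1 ⟨g1, g2⟩
    · rcases fTen_step hn hi hu.1 hu.2 with ⟨ha, _⟩ | ⟨u', ha, g1, g2, _⟩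
      · rw [ha]; rfl
      · rw [ha]; simp only [Option.map_some, Option.some.injEq]
        exact hinv.1 ⟨g1, g2⟩
  · intro u h1 h2
    exact hinv.1 ⟨h1, h2⟩

/-- **Claim 1 of Section 4.4.**  The isomorphism preserves the number
`min(x₀(b₁), x₀(b₂))` of removable `(0,0̄)` pairs. -/
theorem claim_pairs_preserved
    (n l k : ℕ) (hn : 2 ≤ n) (hl : 1 ≤ l) (hk : 1 ≤ k)
    (ι : Tup n × Tup n → Tup n × Tup n) (hι : IsIsoC n l k ι)
    (b1 b2 : Tup n) (hb1 : b1 ∈ BC n l) (hb2 : b2 ∈ BC n k) :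
    min (x0 l b1) (x0 k b2) =
      min (x0 l (ι (b1, b2)).2) (x0 k (ι (b1, b2)).1) := by
  obtain ⟨ι', h', hinv⟩ := iso_symm n l k hn ι hι
  obtain ⟨m1, m2⟩ := iso_mem hι (u := (b1, b2)) hb1 hb2
  have A := core n l k hn ι hι (min (x0 l b1) (x0 k b2)) (b1, b2) hb1 hb2
    (min_le_left _ _) (min_le_right _ _)
  have B := core n k l hn ι' h' (min (x0 l (ι (b1, b2)).2) (x0 k (ι (b1, b2)).1)) (ι (b1, b2))
    m1 m2 (min_le_right _ _) (min_le_left _ _)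
  rw [hinv (b1, b2) hb1 hb2] at B
  simp only at B
  exact le_antisymm (le_min A.2 A.1) (le_min B.1 B.2)
end KTT
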